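/- arXiv:2410.20764 — 12 statements merged into one kernel-verified Lean document; each statement's English description precedes it below -/
import Mathlib

section
/- Let M ≥ 2 be an integer and let Ŝ be a nonempty subset of ℤ/Mℤ. Then there exists a subset Δ ⊆ ℤ/Mℤ such that Ŝ + Δ = ℤ/Mℤ and |Δ| ≤ 2M·ln(M)/|Ŝ|. -/
open scoped Pointwise

/-- Some translate of `S` covers at least the average proportion of `U`. -/
theorem exists_card_mul_card_le_card_filter_sub_mem {G : Type*} [AddCommGroup G] [Fintype G]
    [DecidableEq G] (S U : Finset G) :
    ∃ t : G, S.card * U.card ≤ Fintype.card G * (U.filter fun u => u - t ∈ S).card := by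
  have hsum : ∑ t : G, (U.filter fun u => u - t ∈ S).card = S.card * U.card := by
    simp_rw [Finset.card_filter]
    rw [Finset.sum_comm]
    have hfib : ∀ u ∈ U, (∑ t : G, if u - t ∈ S then 1 else 0) = S.card := by
      intro u _
      exact ((Equiv.subLeft u).sum_comp (fun x => if x ∈ S then 1 else 0)).trans (by simp)
    rw [Finset.sum_congr rfl hfib, Finset.sum_const, smul_eq_mul, mul_comm]
  obtain ⟨t, -, ht⟩ := Finset.exists_max_image Finset.univ
    (fun t : G => (U.filter fun u => u - t ∈ S).card) Finset.univ_nonempty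
  refine ⟨t, ?_⟩
  rw [← hsum]
  simpa using Finset.sum_le_card_nsmul Finset.univ _ _ ht

/-- Greedy covering: `k` translates of `S` can leave at most a proportion
`(1 - |S| / |G|) ^ k` of the group uncovered. -/
theorem exists_card_le_card_compl_add_le {G : Type*} [AddCommGroup G] [Fintype G]
    [DecidableEq G] (S : Finset G) (k : ℕ) :
    ∃ Δ : Finset G, Δ.card ≤ k ∧ ((S + Δ)ᶜ.card : ℝ) ≤
      Fintype.card G * (1 - (S.card : ℝ) / Fintype.card G) ^ k := by
  have hG : (0 : ℝ) < Fintype.card G := by exact_mod_cast Fintype.card_pos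
  have hS : (0 : ℝ) ≤ 1 - (S.card : ℝ) / Fintype.card G := by
    rw [sub_nonneg, div_le_one hG]
    exact_mod_cast S.card_le_univ
  induction k with
  | zero => exact ⟨∅, by simp, by simp⟩
  | succ k ih =>
    obtain ⟨Δ, hcard, hΔ⟩ := ih
    obtain ⟨t, ht⟩ := exists_card_mul_card_le_card_filter_sub_mem S (S + Δ)ᶜ
    refine ⟨insert t Δ, (Finset.card_insert_le t Δ).trans (by omega), ?_⟩
    have hsub : (S + insert t Δ)ᶜ ⊆ (S + Δ)ᶜ.filter fun u => u - t ∉ S := by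
      intro u hu
      rw [Finset.mem_compl] at hu
      rw [Finset.mem_filter, Finset.mem_compl]
      refine ⟨fun h => hu (Finset.add_subset_add_left (Finset.subset_insert t Δ) h),
        fun h => hu ?_⟩
      simpa using Finset.add_mem_add h (Finset.mem_insert_self t Δ)
    have hle : ((S + insert t Δ)ᶜ.card : ℝ) ≤ ((S + Δ)ᶜ.filter fun u => u - t ∉ S).card := by
      exact_mod_cast Finset.card_le_card hsub
    have hsplit : (((S + Δ)ᶜ.filter fun u => u - t ∈ S).card : ℝ) +
        ((S + Δ)ᶜ.filter fun u => u - t ∉ S).card = (S + Δ)ᶜ.card := by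
      exact_mod_cast Finset.card_filter_add_card_filter_not _
    have ht' : (S.card : ℝ) / Fintype.card G * (S + Δ)ᶜ.card ≤
        ((S + Δ)ᶜ.filter fun u => u - t ∈ S).card := by
      rw [div_mul_eq_mul_div, div_le_iff₀' hG]
      exact_mod_cast ht
    calc ((S + insert t Δ)ᶜ.card : ℝ)
        ≤ (1 - (S.card : ℝ) / Fintype.card G) * (S + Δ)ᶜ.card := by linarith
      _ ≤ (1 - (S.card : ℝ) / Fintype.card G) *
          (Fintype.card G * (1 - (S.card : ℝ) / Fintype.card G) ^ k) := by gcongr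
      _ = Fintype.card G * (1 - (S.card : ℝ) / Fintype.card G) ^ (k + 1) := by ring

/-- A nonempty subset `S` of a finite abelian group `G` has at most `⌈|G| log |G| / |S|⌉`
translates covering `G`. -/
theorem exists_add_eq_univ_card_le_ceil {G : Type*} [AddCommGroup G] [Fintype G] [Nontrivial G]
    [DecidableEq G] {S : Finset G} (hS : S.Nonempty) :
    ∃ Δ : Finset G, S + Δ = Finset.univ ∧
      Δ.card ≤ ⌈(Fintype.card G : ℝ) * Real.log (Fintype.card G) / S.card⌉₊ := by
  set n := (Fintype.card G : ℝ)
  set s := (S.card : ℝ)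
  have hn1 : 1 < n := Nat.one_lt_cast.2 Fintype.one_lt_card
  have hn0 : 0 < n := by linarith
  have hs0 : 0 < s := Nat.cast_pos.2 hS.card_pos
  have hsn : s ≤ n := Nat.cast_le.2 S.card_le_univ
  set k := ⌈n * Real.log n / s⌉₊
  have hpos : 0 < n * Real.log n / s := by have := Real.log_pos hn1; positivity
  have hk0 : k ≠ 0 := (Nat.ceil_pos.2 hpos).ne'
  obtain ⟨Δ, hcard, hΔ⟩ := exists_card_le_card_compl_add_le S k
  refine ⟨Δ, ?_, hcard⟩
  have hbase : 1 - s / n < Real.exp (-(s / n)) := by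
    have := Real.add_one_lt_exp (x := -(s / n)) (by have := div_pos hs0 hn0; linarith)
    linarith
  have hexponent : Real.log n ≤ k * (s / n) := by
    have h := Nat.le_ceil (n * Real.log n / s)
    rw [div_le_iff₀ hs0] at h
    rw [← mul_div_assoc, le_div_iff₀ hn0]
    linarith
  have hlt : ((S + Δ)ᶜ.card : ℝ) < 1 := by
    calc ((S + Δ)ᶜ.card : ℝ) ≤ n * (1 - s / n) ^ k := hΔ
      _ < n * Real.exp (-(s / n)) ^ k := by
        have := pow_lt_pow_left₀ hbase (sub_nonneg.2 ((div_le_one hn0).2 hsn)) hk0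
        gcongr
      _ = n * Real.exp (-(k * (s / n))) := by rw [← Real.exp_nat_mul, mul_neg]
      _ ≤ n * Real.exp (-Real.log n) := by gcongr
      _ = 1 := by rw [Real.exp_neg, Real.exp_log hn0, mul_inv_cancel₀ hn0.ne']
  have hzero : (S + Δ)ᶜ.card = 0 := by
    have : (S + Δ)ᶜ.card < 1 := by exact_mod_cast hlt
    omega
  simpa using hzero

theorem stmt_2 (M : ℕ) [NeZero M] (hM : 2 ≤ M) (S : Finset (ZMod M)) (hS : S.Nonempty) :
    ∃ Δ : Finset (ZMod M), S + Δ = Finset.univ ∧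
      (Δ.card : ℝ) ≤ 2 * M * Real.log M / S.card := by
  have : Fact (1 < M) := ⟨hM⟩
  have hM2 : (2 : ℝ) ≤ M := by exact_mod_cast hM
  have hs0 : (0 : ℝ) < S.card := by exact_mod_cast hS.card_pos
  have hSM : S.card ≤ M := by simpa [ZMod.card] using S.card_le_univ
  rcases hSM.eq_or_lt with heq | hlt
  · have hSuniv : S = Finset.univ := by
      rw [← Finset.card_eq_iff_eq_univ, heq, ZMod.card]
    refine ⟨{0}, by rw [hSuniv, Finset.singleton_zero, add_zero], ?_⟩
    rw [heq, Finset.card_singleton, Nat.cast_one, mul_right_comm,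
      mul_div_cancel_right₀ _ (by positivity)]
    have := Real.log_le_log (by norm_num) hM2
    have := Real.log_two_gt_d9
    linarith
  · obtain ⟨Δ, hΔ, hcard⟩ := exists_add_eq_univ_card_le_ceil hS
    refine ⟨Δ, hΔ, ?_⟩
    rw [ZMod.card] at hcard
    have hlog : (M : ℝ) - 1 ≤ M * Real.log M := by
      have h := Real.one_sub_inv_le_log_of_pos (x := (M : ℝ)) (by linarith)
      calc (M : ℝ) - 1 = M * (1 - (M : ℝ)⁻¹) := by field_simp
        _ ≤ M * Real.log M := by gcongr
    have hsM : (S.card : ℝ) + 1 ≤ M := by exact_mod_cast hlt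
    have hone : 1 ≤ M * Real.log M / S.card := by
      rw [one_le_div hs0]
      linarith
    have hceil := Nat.ceil_lt_add_one (zero_le_one.trans hone)
    have hcard' : (Δ.card : ℝ) ≤ ⌈(M : ℝ) * Real.log M / S.card⌉₊ := by exact_mod_cast hcard
    have htwo : 2 * (M : ℝ) * Real.log M / S.card = 2 * (M * Real.log M / S.card) := by ring
    rw [htwo]
    linarith
end

section
/- Let A, B be finite sets of integers and let k be a natural number with k < |B|. Then every finite set C of integers such that |(c + B) \ A| ≤ k holds for every c ∈ C satisfies |C| · (|B| − k) ≤ |A| · |B|. -/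
open scoped Pointwise

theorem stmt_5 (A B : Finset ℤ) (k : ℕ) (hk : k < B.card) (C : Finset ℤ)
    (hC : ∀ c ∈ C, ((({c} : Finset ℤ) + B) \ A).card ≤ k) :
    C.card * (B.card - k) ≤ A.card * B.card := by
  classical
  refine Finset.card_mul_le_card_mul (fun c a => a ∈ ({c} : Finset ℤ) + B) (fun c hc => ?_)
    (fun a _ => ?_)
  · have hsplit := Finset.card_sdiff_add_card_inter (({c} : Finset ℤ) + B) A
    have hcard : (({c} : Finset ℤ) + B).card = B.card := by
      rw [Finset.singleton_add, Finset.card_vadd_finset]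
    have hinter : Finset.bipartiteAbove (fun c a => a ∈ ({c} : Finset ℤ) + B) A c =
        (({c} : Finset ℤ) + B) ∩ A := by
      ext x
      simp only [Finset.mem_bipartiteAbove, Finset.mem_inter, and_comm]
    have hle := hC c hc
    rw [hinter]
    omega
  · refine Finset.card_le_card_of_injOn (fun c => a - c) (fun c hc => ?_) (fun c _ d _ h => ?_)
    · obtain ⟨-, hmem⟩ := (Finset.mem_bipartiteBelow _).mp hc
      obtain ⟨x, hx, b, hb, rfl⟩ := Finset.mem_add.mp hmem
      obtain rfl := Finset.mem_singleton.mp hx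
      simpa using hb
    · exact sub_right_injective h
end

section
/- Let A, B, C be finite sets of integers and let k be a natural number with 5k ≤ 2|B|. If every c ∈ C satisfies |(c + B) \ A| ≤ k, then |C − C| · |B| ≤ 5|A|^2. -/
open scoped Pointwise

/-- The elements of `B` moved out of `A` by translation by `c` are counted by `({c} + B) \ A`. -/
theorem card_filter_add_notMem (A B : Finset ℤ) (c : ℤ) :
    (B.filter fun b => c + b ∉ A).card = (({c} + B) \ A).card := by
  rw [← Finset.card_image_of_injective _ (add_right_injective c)]
  congr 1
  ext x
  simp only [Finset.mem_image, Finset.mem_filter, Finset.mem_sdiff, Finset.singleton_add,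
    Finset.mem_vadd_finset, vadd_eq_add]
  constructor
  · rintro ⟨b, ⟨hb, hA⟩, rfl⟩
    exact ⟨⟨b, hb, rfl⟩, hA⟩
  · rintro ⟨⟨b, hb, rfl⟩, hA⟩
    exact ⟨b, ⟨hb, hA⟩, rfl⟩

/-- If two translates of `B` are nearly contained in `A`, the difference of the translation
parameters has many representations as a difference of two elements of `A`. -/
theorem card_le_card_filter_sub_eq_add (A B : Finset ℤ) (c d : ℤ) :
    B.card ≤ ((A ×ˢ A).filter fun p => p.1 - p.2 = c - d).card
      + ((({c} + B) \ A).card + (({d} + B) \ A).card) := by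
  rw [← card_filter_add_notMem, ← card_filter_add_notMem]
  have hgood : (B.filter fun b => c + b ∈ A ∧ d + b ∈ A).card
      ≤ ((A ×ˢ A).filter fun p => p.1 - p.2 = c - d).card := by
    refine Finset.card_le_card_of_injOn (fun b => (c + b, d + b)) ?_ ?_
    · intro b hb
      have hb' := (Finset.mem_filter.mp hb).2
      exact Finset.mem_filter.mpr ⟨Finset.mem_product.mpr hb', by ring⟩
    · intro b _ b' _ h
      exact add_left_cancel (Prod.mk.inj h).1
  have hcover : B ⊆ (B.filter fun b => c + b ∈ A ∧ d + b ∈ A) ∪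
      ((B.filter fun b => c + b ∉ A) ∪ B.filter fun b => d + b ∉ A) := by
    intro b hb
    simp only [Finset.mem_union, Finset.mem_filter]
    tauto
  calc B.card ≤ _ := Finset.card_le_card hcover
    _ ≤ _ := Finset.card_union_le _ _
    _ ≤ _ := add_le_add hgood (Finset.card_union_le _ _)

theorem stmt_7 (A B C : Finset ℤ) (k : ℕ) (hk : 5 * k ≤ 2 * B.card)
    (hC : ∀ c ∈ C, ((({c} : Finset ℤ) + B) \ A).card ≤ k) :
    (C - C).card * B.card ≤ 5 * A.card ^ 2 := by
  have hfiber : ∀ x ∈ C - C,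
      B.card ≤ 5 * ((A ×ˢ A).filter fun p => p.1 - p.2 = x).card := by
    intro x hx
    obtain ⟨c, hc, d, hd, rfl⟩ := Finset.mem_sub.mp hx
    have h := card_le_card_filter_sub_eq_add A B c d
    have h₁ := hC c hc
    have h₂ := hC d hd
    omega
  calc (C - C).card * B.card
      ≤ ∑ x ∈ C - C, 5 * ((A ×ˢ A).filter fun p => p.1 - p.2 = x).card :=
        Finset.card_nsmul_le_sum _ _ _ hfiber
    _ = 5 * ∑ x ∈ C - C, ((A ×ˢ A).filter fun p => p.1 - p.2 = x).card :=
        (Finset.mul_sum _ _ _).symm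
    _ ≤ 5 * (A ×ˢ A).card := by
        rw [Finset.sum_card_fiberwise_eq_card_filter]
        exact Nat.mul_le_mul_left 5 (Finset.card_filter_le _ _)
    _ = 5 * A.card ^ 2 := by rw [Finset.card_product, sq]
end

section
/- Let A, B, C be finite sets of integers with C nonempty, let k be a natural number with 5k ≤ 2|B|, and let R ≥ 1 be a real number with |A| ≤ R · |C|. Suppose every c ∈ C satisfies |(c + B) \ A| ≤ k. Define B' = {b ∈ B : 4 · |{c ∈ C : b + c ∈ A}| ≥ |C|}. Then |B' + C| · |B| ≤ 20 R |A|^2. -/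
open scoped Pointwise

lemma card_filter_add_notMem_le (A B : Finset ℤ) (c : ℤ) :
    (B.filter fun b => c + b ∉ A).card ≤ ((({c} : Finset ℤ) + B) \ A).card := by
  refine Finset.card_le_card_of_injOn (fun b => c + b) ?_ (fun x _ y _ h => by simpa using h)
  intro b hb
  obtain ⟨hbB, hbA⟩ := Finset.mem_filter.1 (Finset.mem_coe.1 hb)
  exact Finset.mem_coe.2 (Finset.mem_sdiff.2
    ⟨Finset.add_mem_add (Finset.mem_singleton_self c) hbB, hbA⟩)

/-- If two translates of `B` are both mostly in `A`, a fifth of `B` is translated into `A` by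
both. -/
lemma card_le_five_mul_card_filter (A B : Finset ℤ) (k : ℕ) (hk : 5 * k ≤ 2 * B.card) (c d : ℤ)
    (hc : ((({c} : Finset ℤ) + B) \ A).card ≤ k) (hd : ((({d} : Finset ℤ) + B) \ A).card ≤ k) :
    B.card ≤ 5 * (B.filter fun b => c + b ∈ A ∧ d + b ∈ A).card := by
  have hsub : B ⊆ (B.filter fun b => c + b ∈ A ∧ d + b ∈ A) ∪
      ((B.filter fun b => c + b ∉ A) ∪ (B.filter fun b => d + b ∉ A)) := by
    intro b hb
    simp only [Finset.mem_union, Finset.mem_filter]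
    tauto
  have h1 := Finset.card_le_card hsub
  have h2 := Finset.card_union_le (B.filter fun b => c + b ∈ A ∧ d + b ∈ A)
    ((B.filter fun b => c + b ∉ A) ∪ (B.filter fun b => d + b ∉ A))
  have h3 := Finset.card_union_le (B.filter fun b => c + b ∉ A) (B.filter fun b => d + b ∉ A)
  have h4 := card_filter_add_notMem_le A B c
  have h5 := card_filter_add_notMem_le A B d
  omega

/-- A popular sum `b + c` has many representations
`b + c = (b + c') + (c + b') - (c' + b')` as `a₁ + a₂ - a₃` with entries in `A`. -/
lemma card_mul_card_le_card_representations (A B C : Finset ℤ) (k : ℕ)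
    (hk : 5 * k ≤ 2 * B.card)
    (hmis : ∀ c ∈ C, ((({c} : Finset ℤ) + B) \ A).card ≤ k) (b c : ℤ) (hc : c ∈ C)
    (hb : C.card ≤ 4 * (C.filter fun c => b + c ∈ A).card) :
    C.card * B.card ≤
      20 * ((A ×ˢ A ×ˢ A).filter fun t => t.1 + t.2.1 - t.2.2 = b + c).card := by
  set D := C.filter fun c => b + c ∈ A with hD
  set P : Finset (Σ _ : ℤ, ℤ) :=
    D.sigma fun c' => B.filter fun b' => c + b' ∈ A ∧ c' + b' ∈ A with hP
  have hPcard : D.card * B.card ≤ 5 * P.card := by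
    rw [hP, Finset.card_sigma, Finset.mul_sum, ← smul_eq_mul]
    exact Finset.card_nsmul_le_sum _ _ _ fun c' hc' =>
      card_le_five_mul_card_filter A B k hk c c' (hmis c hc)
        (hmis c' (Finset.mem_filter.1 hc').1)
  have hPle : P.card ≤
      ((A ×ˢ A ×ˢ A).filter fun t => t.1 + t.2.1 - t.2.2 = b + c).card := by
    refine Finset.card_le_card_of_injOn (fun p => (b + p.1, c + p.2, p.1 + p.2)) ?_ ?_
    · intro p hp
      simp only [hP, hD, Finset.coe_sigma, Set.mem_sigma_iff, Finset.mem_coe,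
        Finset.mem_filter] at hp
      simp only [Finset.coe_filter, Finset.mem_product, Set.mem_ofPred_eq]
      exact ⟨⟨hp.1.2, hp.2.2⟩, by ring⟩
    · rintro ⟨x, y⟩ _ ⟨x', y'⟩ _ h
      simp only [Prod.mk.injEq, add_right_inj] at h
      obtain ⟨rfl, rfl, _⟩ := h
      rfl
  nlinarith [Nat.mul_le_mul_right B.card hb]

theorem stmt_8 (A B C : Finset ℤ) (hC : C.Nonempty) (k : ℕ) (hk : 5 * k ≤ 2 * B.card)
    (R : ℝ) (hR : 1 ≤ R) (hAC : (A.card : ℝ) ≤ R * C.card)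
    (hmis : ∀ c ∈ C, ((({c} : Finset ℤ) + B) \ A).card ≤ k)
    (B' : Finset ℤ)
    (hB' : B' = B.filter fun b => C.card ≤ 4 * (C.filter fun c => b + c ∈ A).card) :
    ((B' + C).card : ℝ) * B.card ≤ 20 * R * (A.card : ℝ) ^ 2 := by
  have hsum : (B' + C).card * (C.card * B.card) ≤ 20 * A.card ^ 3 := by
    calc (B' + C).card * (C.card * B.card)
        ≤ ∑ x ∈ B' + C,
            20 * ((A ×ˢ A ×ˢ A).filter fun t => t.1 + t.2.1 - t.2.2 = x).card := by
          rw [← smul_eq_mul]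
          refine Finset.card_nsmul_le_sum _ _ _ fun x hx => ?_
          obtain ⟨b, hb, c, hc, rfl⟩ := Finset.mem_add.1 hx
          rw [hB', Finset.mem_filter] at hb
          exact card_mul_card_le_card_representations A B C k hk hmis b c hc hb.2
      _ ≤ 20 * (A ×ˢ A ×ˢ A).card := by
          rw [← Finset.mul_sum, Finset.sum_card_fiberwise_eq_card_filter]
          exact Nat.mul_le_mul_left 20 (Finset.card_filter_le _ _)
      _ = 20 * A.card ^ 3 := by
          rw [Finset.card_product, Finset.card_product]
          ring
  have hsumR : ((B' + C).card : ℝ) * (C.card * B.card) ≤ 20 * (A.card : ℝ) ^ 3 := by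
    exact_mod_cast hsum
  have hCpos : (0 : ℝ) < C.card := by exact_mod_cast hC.card_pos
  refine le_of_mul_le_mul_right ?_ hCpos
  calc ((B' + C).card : ℝ) * B.card * C.card
      = ((B' + C).card : ℝ) * (C.card * B.card) := by ring
    _ ≤ 20 * (A.card : ℝ) ^ 2 * A.card := by linarith
    _ ≤ 20 * (A.card : ℝ) ^ 2 * (R * C.card) := by gcongr
    _ = 20 * R * (A.card : ℝ) ^ 2 * C.card := by ring
end

section
/- Let X, Y, A, B be finite sets of integers and let t > 0 be a real number. If every s ∈ X satisfies r_{A,B}(s) ≥ t, then t · |X + Y| ≤ |B| · |A + Y|. -/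
open scoped Pointwise

/-- `repCount X Y s` is the number of pairs `(x, y) ∈ X × Y` with `x + y = s`. -/
def repCount (X Y : Finset ℤ) (s : ℤ) : ℕ :=
  ((X ×ˢ Y).filter fun p => p.1 + p.2 = s).card

/-- Translating by `y ∈ Y` sends representations of `x` in `A + B` injectively to representations
of `x + y` in `B + (A + Y)`. -/
theorem repCount_le_repCount_add (A B Y : Finset ℤ) (x : ℤ) {y : ℤ} (hy : y ∈ Y) :
    repCount A B x ≤ repCount B (A + Y) (x + y) := by
  refine Finset.card_le_card_of_injOn (fun p => (p.2, p.1 + y)) ?_ ?_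
  · rintro ⟨a, b⟩ h
    simp only [Finset.coe_filter, Finset.mem_product, Set.mem_ofPred_eq] at h ⊢
    exact ⟨⟨h.1.2, Finset.add_mem_add h.1.1 hy⟩, by lia⟩
  · rintro ⟨a, b⟩ - ⟨c, d⟩ - h
    simp only [Prod.mk.injEq] at h ⊢
    lia

theorem sum_repCount_le (S X Y : Finset ℤ) :
    ∑ s ∈ S, repCount X Y s ≤ X.card * Y.card := by
  simp only [repCount]
  rw [← Finset.card_product, Finset.sum_card_fiberwise_eq_card_filter]
  exact Finset.card_filter_le _ _

theorem stmt_10 (X Y A B : Finset ℤ) (t : ℝ) (ht : 0 < t)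
    (hX : ∀ s ∈ X, t ≤ (repCount A B s : ℝ)) :
    t * ((X + Y).card : ℝ) ≤ (B.card : ℝ) * ((A + Y).card : ℝ) := by
  have hz : ∀ z ∈ X + Y, t ≤ (repCount B (A + Y) z : ℝ) := by
    intro z hz
    obtain ⟨x, hx, y, hy, rfl⟩ := Finset.mem_add.mp hz
    exact (hX x hx).trans (by exact_mod_cast repCount_le_repCount_add A B Y x hy)
  calc t * ((X + Y).card : ℝ) = ∑ _z ∈ X + Y, t := by
        rw [Finset.sum_const, nsmul_eq_mul, mul_comm]
    _ ≤ ∑ z ∈ X + Y, (repCount B (A + Y) z : ℝ) := Finset.sum_le_sum hz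
    _ ≤ (B.card : ℝ) * ((A + Y).card : ℝ) := by
        exact_mod_cast sum_repCount_le (X + Y) B (A + Y)
end

section
/- Let m ≥ 1 be an integer and let A, B be finite sets of integers. For a positive integer q, define A_q = {a mod q : a ∈ A} + {0, q} and B_q = {b mod q : b ∈ B}, where a mod q denotes the least nonnegative residue of a modulo q. Then for every integer c with 0 ≤ c < 2m, |(c + B_{2m}) \ A_{2m}| ≥ |((c mod m) + B_m) \ A_m|. -/
open scoped Pointwise

theorem stmt_11 (m : ℤ) (hm : 1 ≤ m) (A B : Finset ℤ)
    (Aq Bq : ℤ → Finset ℤ)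
    (hAq : ∀ q : ℤ, Aq q = A.image (fun a => a % q) + ({0, q} : Finset ℤ))
    (hBq : ∀ q : ℤ, Bq q = B.image (fun b => b % q))
    (c : ℤ) (hc0 : 0 ≤ c) (hc : c < 2 * m) :
    ((({c % m} : Finset ℤ) + Bq m) \ Aq m).card ≤
      ((({c} : Finset ℤ) + Bq (2 * m)) \ Aq (2 * m)).card := by
  have emod_two_mul_emod (a : ℤ) : a % (2 * m) % m = a % m :=
    Int.emod_emod_of_dvd a (Dvd.intro_left 2 rfl)
  have mem_Aq (q z : ℤ) : z ∈ Aq q ↔ ∃ a ∈ A, z = a % q ∨ z = a % q + q := by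
    simp only [hAq, Finset.mem_add, Finset.mem_image, Finset.mem_insert, Finset.mem_singleton]
    constructor
    · rintro ⟨_, ⟨a, ha, rfl⟩, _, rfl | rfl, rfl⟩
      · exact ⟨a, ha, Or.inl (add_zero _)⟩
      · exact ⟨a, ha, Or.inr rfl⟩
    · rintro ⟨a, ha, rfl | rfl⟩
      · exact ⟨_, ⟨a, ha, rfl⟩, 0, Or.inl rfl, add_zero _⟩
      · exact ⟨_, ⟨a, ha, rfl⟩, q, Or.inr rfl, rfl⟩
  have mem_add_Bq (d q z : ℤ) : z ∈ ({d} : Finset ℤ) + Bq q ↔ ∃ b ∈ B, d + b % q = z := by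
    simp [hBq, Finset.mem_add]
  refine (Finset.card_le_card ?_).trans
    (Finset.card_image_le (f := fun y => c % m + (y - c) % m))
  intro z hz
  obtain ⟨hzB, hzA⟩ := Finset.mem_sdiff.1 hz
  obtain ⟨b, hb, rfl⟩ := (mem_add_Bq _ _ _).1 hzB
  refine Finset.mem_image.2 ⟨c + b % (2 * m), Finset.mem_sdiff.2
    ⟨(mem_add_Bq _ _ _).2 ⟨b, hb, rfl⟩, fun hy => hzA ?_⟩, by simp [emod_two_mul_emod]⟩
  obtain ⟨a, ha, h⟩ := (mem_Aq _ _).1 hy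
  have hmod : (c % m + b % m) % m = a % m := by
    calc (c % m + b % m) % m = (c + b % (2 * m)) % m := by
          rw [← Int.add_emod, Int.add_emod c (b % (2 * m)), emod_two_mul_emod, ← Int.add_emod]
      _ = a % m := by
          rcases h with h | h
          · rw [h, emod_two_mul_emod]
          · rw [h, Int.add_mul_emod_self_right, emod_two_mul_emod]
  refine (mem_Aq _ _).2 ⟨a, ha, ?_⟩
  have hc_nonneg := Int.emod_nonneg c (by lia : m ≠ 0)
  have hb_nonneg := Int.emod_nonneg b (by lia : m ≠ 0)
  have hc_lt := Int.emod_lt_of_pos c (by lia : 0 < m)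
  have hb_lt := Int.emod_lt_of_pos b (by lia : 0 < m)
  rcases lt_or_ge (c % m + b % m) m with hlt | hge
  · left
    rw [← hmod, Int.emod_eq_of_lt (by lia) hlt]
  · right
    rw [← hmod, ← Int.sub_emod_right (c % m + b % m),
      Int.emod_eq_of_lt (a := c % m + b % m - m) (by lia) (by lia)]
    ring
end

section
/- Let n ≥ m ≥ 1 be integers, let T : {1, …, n} → {1, …, n} and P : {1, …, m} → {1, …, n}, and set M = 10n. Define A = {1, …, 2n} ∪ {i + M·T(i) : 1 ≤ i ≤ n} and B = {1, …, n} ∪ {i + M·P(i) : 1 ≤ i ≤ m}. Then for every integer c with 0 ≤ c ≤ n − m, |(c + B) \ A| equals the number of indices 1 ≤ i ≤ m with P(i) ≠ T(i + c). -/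
open scoped Pointwise

/-- Uniqueness of quotient and remainder for two representations with remainders in `[0, M)`. -/
theorem add_mul_inj_of_lt {M r s a b : ℤ} (hr : 0 ≤ r) (hrM : r < M) (hs : 0 ≤ s) (hsM : s < M)
    (h : r + M * a = s + M * b) : r = s ∧ a = b := by
  have hM : M ≠ 0 := by lia
  have hrs : r = s := by
    have h' := congrArg (· % M) h
    simpa [Int.add_mul_emod_self_left, Int.emod_eq_of_lt hr hrM, Int.emod_eq_of_lt hs hsM] using h'
  subst hrs
  exact ⟨rfl, mul_left_cancel₀ hM (add_left_cancel h)⟩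

theorem stmt_13 (n m : ℕ) (hm : 1 ≤ m) (hmn : m ≤ n)
    (T P : ℕ → ℕ)
    (hT : ∀ i, 1 ≤ i → i ≤ n → 1 ≤ T i ∧ T i ≤ n)
    (hP : ∀ i, 1 ≤ i → i ≤ m → 1 ≤ P i ∧ P i ≤ n)
    (A B : Finset ℤ)
    (hA : A = ((Finset.Icc 1 (2 * n)).image fun x : ℕ => (x : ℤ)) ∪
      ((Finset.Icc 1 n).image fun i : ℕ => (i : ℤ) + 10 * (n : ℤ) * (T i : ℤ)))
    (hB : B = ((Finset.Icc 1 n).image fun x : ℕ => (x : ℤ)) ∪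
      ((Finset.Icc 1 m).image fun i : ℕ => (i : ℤ) + 10 * (n : ℤ) * (P i : ℤ)))
    (c : ℕ) (hc : c ≤ n - m) :
    ((({(c : ℤ)} : Finset ℤ) + B) \ A).card =
      ((Finset.Icc 1 m).filter fun i => P i ≠ T (i + c)).card := by
  have key : (({(c : ℤ)} : Finset ℤ) + B) \ A =
      ((Finset.Icc 1 m).filter fun i => P i ≠ T (i + c)).image
        fun i : ℕ => ((i + c : ℕ) : ℤ) + 10 * (n : ℤ) * (P i : ℤ) := by
    ext z
    simp only [hA, hB, Finset.singleton_add, Finset.mem_vadd_finset, Finset.mem_sdiff,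
      Finset.mem_image, Finset.mem_union,
      Finset.mem_filter, Finset.mem_Icc, not_or, not_exists, not_and, vadd_eq_add]
    constructor
    · rintro ⟨⟨y, ⟨x, hx, rfl⟩ | ⟨i, hi, rfl⟩, rfl⟩, hlow, hhigh⟩
      · exact absurd (by push_cast; ring) (hlow (x + c) (by lia))
      · refine ⟨i, ⟨hi, fun hPT => hhigh (i + c) (by lia) ?_⟩, ?_⟩
        · rw [hPT]
          push_cast
          ring
        · push_cast
          ring
    · rintro ⟨i, ⟨hi, hPT⟩, rfl⟩
      refine ⟨⟨(i : ℤ) + 10 * (n : ℤ) * (P i : ℤ), Or.inr ⟨i, hi, rfl⟩, by push_cast; ring⟩, ?_, ?_⟩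
      · intro x hx h
        obtain ⟨-, h0⟩ := add_mul_inj_of_lt (M := 10 * (n : ℤ)) (r := x) (s := (i + c : ℕ))
          (a := 0) (b := P i) (by lia) (by lia) (by lia) (by lia) (by simpa using h)
        have := hP i hi.1 hi.2
        lia
      · intro j hj h
        obtain ⟨hji, hTP⟩ := add_mul_inj_of_lt (by lia) (by lia) (by lia) (by lia) h
        obtain rfl : j = i + c := by exact_mod_cast hji
        exact hPT (by exact_mod_cast hTP.symm)
  rw [key]
  refine Finset.card_image_of_injOn fun i hi j hj h => ?_
  simp only [Finset.coe_filter, Finset.mem_Icc, Set.mem_ofPred_eq] at hi hj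
  have := (add_mul_inj_of_lt (by lia) (by lia) (by lia) (by lia) h).1
  lia
end

section
/- Let N ≥ 1 be an integer and let X, Y, Z be subsets of {−N, …, N}. Define W = (X + 30N) ∪ (Y + 100N) ∪ (Z − 130N). Then there exist a, b, c ∈ W with a + b + c = 0 if and only if there exist x ∈ X, y ∈ Y, z ∈ Z with x + y + z = 0. -/
theorem stmt_14 (N : ℤ) (hN : 1 ≤ N) (X Y Z : Finset ℤ)
    (hX : X ⊆ Finset.Icc (-N) N) (hY : Y ⊆ Finset.Icc (-N) N) (hZ : Z ⊆ Finset.Icc (-N) N)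
    (W : Finset ℤ)
    (hW : W = (X.image fun x => x + 30 * N) ∪ (Y.image fun y => y + 100 * N) ∪
      (Z.image fun z => z - 130 * N)) :
    (∃ a ∈ W, ∃ b ∈ W, ∃ c ∈ W, a + b + c = 0) ↔
      ∃ x ∈ X, ∃ y ∈ Y, ∃ z ∈ Z, x + y + z = 0 := by
  have memW (a : ℤ) : a ∈ W ↔ (∃ x ∈ X, x + 30 * N = a) ∨ (∃ y ∈ Y, y + 100 * N = a) ∨
      ∃ z ∈ Z, z - 130 * N = a := by
    simp only [hW, Finset.mem_union, Finset.mem_image, or_assoc]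
  have boundX (x : ℤ) (hx : x ∈ X) : -N ≤ x ∧ x ≤ N := Finset.mem_Icc.mp (hX hx)
  have boundY (y : ℤ) (hy : y ∈ Y) : -N ≤ y ∧ y ≤ N := Finset.mem_Icc.mp (hY hy)
  have boundZ (z : ℤ) (hz : z ∈ Z) : -N ≤ z ∧ z ≤ N := Finset.mem_Icc.mp (hZ hz)
  constructor
  · rintro ⟨a, ha, b, hb, c, hc, habc⟩
    rw [memW] at ha hb hc
    rcases ha with ⟨u, hu, rfl⟩ | ⟨u, hu, rfl⟩ | ⟨u, hu, rfl⟩ <;>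
    rcases hb with ⟨v, hv, rfl⟩ | ⟨v, hv, rfl⟩ | ⟨v, hv, rfl⟩ <;>
    rcases hc with ⟨w, hw, rfl⟩ | ⟨w, hw, rfl⟩ | ⟨w, hw, rfl⟩ <;>
    first
    | exact ⟨u, hu, v, hv, w, hw, by linarith⟩
    | exact ⟨u, hu, w, hw, v, hv, by linarith⟩
    | exact ⟨v, hv, u, hu, w, hw, by linarith⟩
    | exact ⟨v, hv, w, hw, u, hu, by linarith⟩
    | exact ⟨w, hw, u, hu, v, hv, by linarith⟩
    | exact ⟨w, hw, v, hv, u, hu, by linarith⟩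
    | grind
  · rintro ⟨x, hx, y, hy, z, hz, hxyz⟩
    exact ⟨x + 30 * N, (memW _).mpr (.inl ⟨x, hx, rfl⟩),
      y + 100 * N, (memW _).mpr (.inr (.inl ⟨y, hy, rfl⟩)),
      z - 130 * N, (memW _).mpr (.inr (.inr ⟨z, hz, rfl⟩)), by linarith⟩
end

section
/- Let p be a prime, m ≥ 1 an integer, c = (c_1, …, c_m) ∈ 𝔽_p^m, and let q_1, …, q_{m−1} be positive integers. Define h : ℤ → 𝔽_p by h(x) = c_m + Σ_{i=1}^{m−1} c_i · ((x mod q_i) mod p), where x mod q_i denotes the least nonnegative residue of x modulo q_i, subsequently reduced modulo p. Define Δ ⊆ 𝔽_p as the sumset Δ = {0, −q_1 c_1} + {0, −q_2 c_2} + … + {0, −q_{m−1} c_{m−1}} + {−c_m}, where each q_i is interpreted as an element of 𝔽_p. Then for all x, y ∈ ℤ, h(x + y) − h(x) − h(y) ∈ Δ, and |Δ| ≤ 2^{m−1}. -/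
open scoped Pointwise

theorem sum_mem_sum_finset {ι G : Type*} [AddCommMonoid G] [DecidableEq G] (s : Finset ι)
    (A : ι → Finset G) (f : ι → G) (hf : ∀ i ∈ s, f i ∈ A i) :
    ∑ i ∈ s, f i ∈ ∑ i ∈ s, A i := by
  classical
  induction s using Finset.induction_on with
  | empty => simp
  | insert a s ha ih =>
    rw [Finset.sum_insert ha, Finset.sum_insert ha]
    exact Finset.add_mem_add (hf a (Finset.mem_insert_self a s))
      (ih fun i hi => hf i (Finset.mem_insert_of_mem hi))

theorem card_sum_finset_le_prod {ι G : Type*} [AddCommMonoid G] [DecidableEq G] (s : Finset ι)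
    (A : ι → Finset G) : (∑ i ∈ s, A i).card ≤ ∏ i ∈ s, (A i).card := by
  classical
  induction s using Finset.induction_on with
  | empty => simp
  | insert a s ha ih =>
    rw [Finset.sum_insert ha, Finset.prod_insert ha]
    exact Finset.card_add_le.trans (Nat.mul_le_mul_left _ ih)

/-- The carry when adding residues modulo a positive integer is `0` or the modulus. -/
theorem Int.add_emod_sub_eq_zero_or_neg (x y : ℤ) {n : ℤ} (hn : 0 < n) :
    (x + y) % n - x % n - y % n = 0 ∨ (x + y) % n - x % n - y % n = -n := by
  have hx := Int.emod_nonneg x hn.ne'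
  have hy := Int.emod_nonneg y hn.ne'
  have hxn := Int.emod_lt_of_pos x hn
  have hyn := Int.emod_lt_of_pos y hn
  rw [Int.add_emod]
  rcases lt_or_ge (x % n + y % n) n with hlt | hge
  · left
    rw [Int.emod_eq_of_lt (by omega) hlt]
    ring
  · right
    rw [← Int.sub_emod_right, Int.emod_eq_of_lt (by omega) (by omega)]
    ring

theorem stmt_16 (p : ℕ) (hp : p.Prime) (m' : ℕ) (c : Fin (m' + 1) → ZMod p)
    (q : Fin m' → ℕ) (hq : ∀ i, 0 < q i)
    (h : ℤ → ZMod p)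
    (hh : ∀ x : ℤ, h x = c (Fin.last m') +
      ∑ i : Fin m', c i.castSucc * (((x % (q i : ℤ)) : ℤ) : ZMod p))
    (Δ : Finset (ZMod p))
    (hΔ : Δ = (∑ i : Fin m',
        ({0, -((q i : ZMod p) * c i.castSucc)} : Finset (ZMod p))) +
      ({-(c (Fin.last m'))} : Finset (ZMod p))) :
    (∀ x y : ℤ, h (x + y) - h x - h y ∈ Δ) ∧ Δ.card ≤ 2 ^ m' := by
  subst hΔ
  refine ⟨fun x y => ?_, ?_⟩
  · have hsum : h (x + y) - h x - h y =
        (∑ i : Fin m', c i.castSucc *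
          (((x + y) % (q i : ℤ) - x % (q i : ℤ) - y % (q i : ℤ) : ℤ) : ZMod p)) +
        -(c (Fin.last m')) := by
      simp only [hh, Int.cast_sub, mul_sub, Finset.sum_sub_distrib]
      ring
    rw [hsum]
    refine Finset.add_mem_add (sum_mem_sum_finset _ _ _ fun i _ => ?_)
      (Finset.mem_singleton_self _)
    rw [Finset.mem_insert, Finset.mem_singleton]
    rcases Int.add_emod_sub_eq_zero_or_neg x y (n := q i) (by exact_mod_cast hq i) with h0 | h1
    · left
      rw [h0, Int.cast_zero, mul_zero]
    · right
      rw [h1]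
      push_cast
      ring
  · rw [Finset.add_singleton, Finset.card_vadd_finset]
    refine (card_sum_finset_le_prod _ _).trans ?_
    refine (Finset.prod_le_pow_card _ _ 2 fun i _ => Finset.card_le_two).trans ?_
    simp
end

section
/- Let A be a nonempty finite set of integers and K ≥ 1 a real number with E(A) ≥ |A|^3/K. Let S ⊆ ℤ be any set containing every integer s with r_{A,A}(s) ≥ |A|/(2K). Define B_1 = {b ∈ A : |{a ∈ A : a + b ∈ S}| ≥ |A|/(16K)}. Then |B_1| ≥ 7|A|/(16K) and E(B_1) ≥ |A|^3/(4K). -/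
/-- The additive energy of a finite set of integers:
the number of tuples `(a, a', b, b') ∈ A^4` with `a + b = a' + b'`. -/
def energyZ (A B : Finset ℤ) : ℕ :=
  (((A ×ˢ A) ×ˢ B ×ˢ B).filter fun x => x.1.1 + x.2.1 = x.1.2 + x.2.2).card

theorem Finset.card_le_card_mul_of_card_fiber_le {α β : Type*} [DecidableEq β] {s : Finset α}
    {t : Finset β} {f : α → β} (hf : ∀ x ∈ s, f x ∈ t) {c : ℝ}
    (hc : ∀ y ∈ t, ((s.filter fun x => f x = y).card : ℝ) ≤ c) :
    (s.card : ℝ) ≤ t.card * c := by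
  rw [Finset.card_eq_sum_card_fiberwise (f := f) (t := t) hf]
  push_cast
  simpa using Finset.sum_le_card_nsmul t _ c hc

/-- The additive quadruples of `A`, i.e. the set counted by `energyZ A A`. -/
def additiveQuadruples (A : Finset ℤ) : Finset ((ℤ × ℤ) × ℤ × ℤ) :=
  ((A ×ˢ A) ×ˢ A ×ˢ A).filter fun x => x.1.1 + x.2.1 = x.1.2 + x.2.2

theorem mem_additiveQuadruples {A : Finset ℤ} {x : (ℤ × ℤ) × ℤ × ℤ} :
    x ∈ additiveQuadruples A ↔ ((x.1.1 ∈ A ∧ x.1.2 ∈ A) ∧ x.2.1 ∈ A ∧ x.2.2 ∈ A) ∧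
      x.1.1 + x.2.1 = x.1.2 + x.2.2 := by
  simp [additiveQuadruples]

open scoped Classical in
/-- Few additive quadruples have a sum with few representations. -/
theorem card_additiveQuadruples_filter_notMem_le (A : Finset ℤ) (S : Set ℤ) {c : ℝ}
    (hS : ∀ s : ℤ, c ≤ (repCount A A s : ℝ) → s ∈ S) :
    (((additiveQuadruples A).filter fun x => x.1.1 + x.2.1 ∉ S).card : ℝ) ≤
      (A.card : ℝ) ^ 2 * max c 0 := by
  have key : (((additiveQuadruples A).filter fun x => x.1.1 + x.2.1 ∉ S).card : ℝ) ≤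
      (A ×ˢ A).card * max c 0 := by
    refine Finset.card_le_card_mul_of_card_fiber_le (f := fun x => (x.1.1, x.2.1)) ?_ ?_
    · intro x hx
      simp only [Finset.mem_filter, mem_additiveQuadruples] at hx
      simp [hx]
    · rintro ⟨a, b⟩ -
      by_cases hab : a + b ∈ S
      · rw [Finset.card_eq_zero.mpr]
        · simp
        · ext x
          simp only [Finset.mem_filter, Prod.mk.injEq, Finset.notMem_empty, iff_false]
          rintro ⟨⟨-, h⟩, rfl, rfl⟩
          exact h hab
      · refine le_trans ?_ ((not_le.mp fun h => hab (hS _ h)).le.trans (le_max_left c 0))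
        rw [repCount]
        norm_cast
        refine Finset.card_le_card_of_injOn (fun x => (x.1.2, x.2.2)) ?_ ?_
        · intro x hx
          simp only [Finset.coe_filter, Finset.mem_filter, mem_additiveQuadruples, Set.mem_ofPred_eq,
            Prod.mk.injEq, Finset.mem_product] at hx ⊢
          grind
        · rintro ⟨⟨x, y⟩, z, w⟩ hx ⟨⟨x', y'⟩, z', w'⟩ hx' h
          simp only [Finset.coe_filter, Finset.mem_filter, Set.mem_ofPred_eq, Prod.mk.injEq]
            at hx hx' h ⊢
          grind
  simpa [sq] using key

open scoped Classical in
/-- The pairs `(b, a)` with `b ∈ B`, `a ∈ A` and `a + b ∈ S`. -/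
noncomputable def pairsWithSumIn (B A : Finset ℤ) (S : Set ℤ) : Finset (ℤ × ℤ) :=
  (B ×ˢ A).filter fun p => p.2 + p.1 ∈ S

theorem mem_pairsWithSumIn {B A : Finset ℤ} {S : Set ℤ} {p : ℤ × ℤ} :
    p ∈ pairsWithSumIn B A S ↔ (p.1 ∈ B ∧ p.2 ∈ A) ∧ p.2 + p.1 ∈ S := by
  simp [pairsWithSumIn]

open scoped Classical in
theorem card_pairsWithSumIn_le {B A : Finset ℤ} {S : Set ℤ} {c : ℝ}
    (h : ∀ b ∈ B, ((A.filter fun a => a + b ∈ S).card : ℝ) ≤ c) :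
    ((pairsWithSumIn B A S).card : ℝ) ≤ B.card * c := by
  refine Finset.card_le_card_mul_of_card_fiber_le (f := Prod.fst)
    (fun x hx => (mem_pairsWithSumIn.mp hx).1.1) fun b hb => le_trans ?_ (h b hb)
  norm_cast
  refine Finset.card_le_card_of_injOn Prod.snd ?_ ?_
  · intro x hx
    simp only [Finset.coe_filter, mem_pairsWithSumIn, Set.mem_ofPred_eq] at hx ⊢
    grind
  · intro x hx y hy hxy
    simp only [Finset.coe_filter, Set.mem_ofPred_eq] at hx hy
    exact Prod.ext (hx.2.trans hy.2.symm) hxy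

open scoped Classical in
/-- An additive quadruple is determined by two summands on one side and one on the other. -/
theorem card_filter_additiveQuadruples_le {A : Finset ℤ} (C : Finset ℤ) (S : Set ℤ)
    (p q r : (ℤ × ℤ) × ℤ × ℤ → ℤ)
    (hmem : ∀ x ∈ additiveQuadruples A,
      q x ∈ A ∧ r x ∈ A ∧ q x + p x = x.1.1 + x.2.1)
    (hinj : ∀ x ∈ additiveQuadruples A, ∀ y ∈ additiveQuadruples A,
      p x = p y → q x = q y → r x = r y → x = y) :
    (((additiveQuadruples A).filter fun x => x.1.1 + x.2.1 ∈ S ∧ p x ∈ C).card : ℝ) ≤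
      (pairsWithSumIn C A S).card * A.card := by
  have h := Finset.card_le_card_of_injOn (t := pairsWithSumIn C A S ×ˢ A)
    (s := (additiveQuadruples A).filter fun x => x.1.1 + x.2.1 ∈ S ∧ p x ∈ C)
    (fun x => ((p x, q x), r x)) ?_ ?_
  · rw [Finset.card_product] at h
    exact_mod_cast h
  · intro x hx
    obtain ⟨hx, hS, hC⟩ := Finset.mem_filter.mp hx
    obtain ⟨hq, hr, heq⟩ := hmem x hx
    exact Finset.mem_product.mpr ⟨mem_pairsWithSumIn.mpr ⟨⟨hC, hq⟩, heq ▸ hS⟩, hr⟩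
  · intro x hx y hy hxy
    simp only [Prod.mk.injEq] at hxy
    exact hinj x (Finset.mem_filter.mp hx).1 y (Finset.mem_filter.mp hy).1 hxy.1.1 hxy.1.2 hxy.2

open scoped Classical in
/-- Every additive quadruple of `A` has its sum outside `S`, or has a summand outside `B`,
or is an additive quadruple of `B`. -/
theorem energyZ_le_add (A B : Finset ℤ) (S : Set ℤ) :
    (energyZ A A : ℝ) ≤ ((additiveQuadruples A).filter fun x => x.1.1 + x.2.1 ∉ S).card +
      4 * ((pairsWithSumIn (A \ B) A S).card * A.card) + energyZ B B := by
  let Q (p : (ℤ × ℤ) × ℤ × ℤ → ℤ) :=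
    (additiveQuadruples A).filter fun x => x.1.1 + x.2.1 ∈ S ∧ p x ∈ A \ B
  have hcover : additiveQuadruples A ⊆
      ((additiveQuadruples A).filter fun x => x.1.1 + x.2.1 ∉ S) ∪
      (Q (·.1.1) ∪ Q (·.2.1) ∪ Q (·.1.2) ∪ Q (·.2.2)) ∪ additiveQuadruples B := by
    intro x hx
    have hxA := mem_additiveQuadruples.mp hx
    simp only [Q, Finset.mem_union, Finset.mem_filter, Finset.mem_sdiff, hx, hxA.1, true_and,
      mem_additiveQuadruples (A := B), hxA.2, and_true]
    grind
  have h1 : ((Q (·.1.1)).card : ℝ) ≤ (pairsWithSumIn (A \ B) A S).card * A.card :=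
    card_filter_additiveQuadruples_le _ S (·.1.1) (·.2.1) (·.1.2)
      (by grind [mem_additiveQuadruples]) (by grind [mem_additiveQuadruples])
  have h2 : ((Q (·.2.1)).card : ℝ) ≤ (pairsWithSumIn (A \ B) A S).card * A.card :=
    card_filter_additiveQuadruples_le _ S (·.2.1) (·.1.1) (·.1.2)
      (by grind [mem_additiveQuadruples]) (by grind [mem_additiveQuadruples])
  have h3 : ((Q (·.1.2)).card : ℝ) ≤ (pairsWithSumIn (A \ B) A S).card * A.card :=
    card_filter_additiveQuadruples_le _ S (·.1.2) (·.2.2) (·.1.1)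
      (by grind [mem_additiveQuadruples]) (by grind [mem_additiveQuadruples])
  have h4 : ((Q (·.2.2)).card : ℝ) ≤ (pairsWithSumIn (A \ B) A S).card * A.card :=
    card_filter_additiveQuadruples_le _ S (·.2.2) (·.1.2) (·.1.1)
      (by grind [mem_additiveQuadruples]) (by grind [mem_additiveQuadruples])
  have hcard : energyZ A A ≤ ((additiveQuadruples A).filter fun x => x.1.1 + x.2.1 ∉ S).card +
      ((Q (·.1.1)).card + (Q (·.2.1)).card + (Q (·.1.2)).card + (Q (·.2.2)).card) +
      energyZ B B := by
    refine (Finset.card_le_card hcover).trans ?_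
    refine (Finset.card_union_le _ _).trans (Nat.add_le_add ?_ le_rfl)
    refine (Finset.card_union_le _ _).trans (Nat.add_le_add le_rfl ?_)
    refine (Finset.card_union_le _ _).trans (Nat.add_le_add ?_ le_rfl)
    refine (Finset.card_union_le _ _).trans (Nat.add_le_add ?_ le_rfl)
    exact Finset.card_union_le _ _
  have hcard' : (energyZ A A : ℝ) ≤ _ := Nat.cast_le.mpr hcard
  push_cast at hcard'
  linarith

open scoped Classical in
theorem energyZ_le_add_card_pairsWithSumIn_mul (A : Finset ℤ) (S : Set ℤ) :
    (energyZ A A : ℝ) ≤ ((additiveQuadruples A).filter fun x => x.1.1 + x.2.1 ∉ S).card +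
      (pairsWithSumIn A A S).card * A.card := by
  have h := card_filter_additiveQuadruples_le A S (A := A) (·.2.1) (·.1.1) (·.1.2)
    (by grind [mem_additiveQuadruples]) (by grind [mem_additiveQuadruples])
  have hfilter : ((additiveQuadruples A).filter fun x => x.1.1 + x.2.1 ∈ S ∧ x.2.1 ∈ A) =
      (additiveQuadruples A).filter fun x => x.1.1 + x.2.1 ∈ S :=
    Finset.filter_congr fun x hx => and_iff_left (mem_additiveQuadruples.mp hx).1.2.1
  rw [hfilter] at h
  have hsplit := Finset.card_filter_add_card_filter_not (s := additiveQuadruples A)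
    (fun x => x.1.1 + x.2.1 ∈ S)
  have hsplit' : (energyZ A A : ℝ) = _ := congrArg Nat.cast hsplit.symm
  push_cast at hsplit'
  linarith

theorem card_pairsWithSumIn_le_add (A B : Finset ℤ) (S : Set ℤ) :
    ((pairsWithSumIn A A S).card : ℝ) ≤
      (pairsWithSumIn (A \ B) A S).card + B.card * A.card := by
  have hsub : pairsWithSumIn A A S ⊆ pairsWithSumIn (A \ B) A S ∪ B ×ˢ A := by
    intro p hp
    simp only [Finset.mem_union, mem_pairsWithSumIn, Finset.mem_product, Finset.mem_sdiff] at hp ⊢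
    tauto
  have := (Finset.card_le_card hsub).trans (Finset.card_union_le _ _)
  rw [Finset.card_product] at this
  exact_mod_cast this

open scoped Classical in
theorem stmt_17 (A : Finset ℤ) (hA : A.Nonempty) (K : ℝ) (hK : 1 ≤ K)
    (hE : (A.card : ℝ) ^ 3 / K ≤ (energyZ A A : ℝ))
    (S : Set ℤ) (hS : ∀ s : ℤ, (A.card : ℝ) / (2 * K) ≤ (repCount A A s : ℝ) → s ∈ S)
    (B₁ : Finset ℤ)
    (hB₁ : B₁ = A.filter fun b =>
      (A.card : ℝ) / (16 * K) ≤ ((A.filter fun a => a + b ∈ S).card : ℝ)) :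
    7 * (A.card : ℝ) / (16 * K) ≤ (B₁.card : ℝ) ∧
      (A.card : ℝ) ^ 3 / (4 * K) ≤ (energyZ B₁ B₁ : ℝ) := by
  have hN : (0 : ℝ) < A.card := by exact_mod_cast hA.card_pos
  have hK0 : 0 < K := by linarith
  have hunpop := card_additiveQuadruples_filter_notMem_le A S hS
  rw [max_eq_left (by positivity)] at hunpop
  have hpairs : ((pairsWithSumIn (A \ B₁) A S).card : ℝ) ≤ A.card * (A.card / (16 * K)) := by
    refine (card_pairsWithSumIn_le (c := A.card / (16 * K)) ?_).trans ?_
    · intro b hb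
      simp only [hB₁, Finset.mem_sdiff, Finset.mem_filter, not_and, not_le] at hb
      exact (hb.2 hb.1).le
    · gcongr
      exact Finset.sdiff_subset
  have hquad := energyZ_le_add A B₁ S
  have hall := energyZ_le_add_card_pairsWithSumIn_mul A S
  have hsplit := card_pairsWithSumIn_le_add A B₁ S
  set N := (A.card : ℝ)
  obtain ⟨u, hu⟩ : ∃ u : ℝ, u = N / (16 * K) := ⟨_, rfl⟩
  have e1 : N ^ 3 / K = 16 * N ^ 2 * u := by rw [hu]; field_simp
  have e2 : N / (2 * K) = 8 * u := by rw [hu]; field_simp; norm_num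
  have e3 : 7 * N / (16 * K) = 7 * u := by rw [hu]; ring
  have e4 : N ^ 3 / (4 * K) = 4 * N ^ 2 * u := by rw [hu]; field_simp; norm_num
  rw [e1] at hE
  rw [e2] at hunpop
  rw [← hu] at hpairs
  rw [e3, e4]
  have hpairsN := mul_le_mul_of_nonneg_right hpairs hN.le
  constructor
  · have hsplitN := mul_le_mul_of_nonneg_right hsplit hN.le
    have hN2 : 0 < N ^ 2 := by positivity
    refine le_of_mul_le_mul_left ?_ hN2
    linarith
  · linarith
end

section
/- Let p be a prime and m, k ≥ 1 integers. Then there exists a nonempty finite set C ⊆ 𝔽_p^m with |C| ≤ 4m^2 p^{3k} such that, when c is drawn uniformly at random from C: (1) for every 1 ≤ k' ≤ k and every k'-tuple of linearly independent vectors x_1, …, x_{k'} ∈ 𝔽_p^m, the distribution of (⟨c,x_1⟩, …, ⟨c,x_{k'}⟩) ∈ 𝔽_p^{k'} is (1/(2p^{k−1}))-almost uniform; and (2) for every 1 ≤ k' ≤ k − 1 and arbitrary vectors x_1, …, x_{k'} ∈ 𝔽_p^m, the probability that ⟨c,x_1⟩ = ⟨c,x_2⟩ = … = ⟨c,x_{k'}⟩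 = 0 is at least 1/(2p^{k'}). -/
section SmallBias

variable {p : ℕ} [Fact p.Prime]

open Finset ComplexConjugate

theorem AddChar.sum_comp_linearMap {V : Type*} [AddCommGroup V] [Fintype V] [Module (ZMod p) V]
    {ψ : AddChar (ZMod p) ℂ} (hψ : ψ ≠ 1) (l : V →ₗ[ZMod p] ZMod p) [Decidable (l = 0)] :
    ∑ v, ψ (l v) = if l = 0 then (Fintype.card V : ℂ) else 0 := by
  split_ifs with h
  · simp [h]
  · obtain ⟨z, hz⟩ := AddChar.ne_one_iff.1 hψ
    obtain ⟨v, hv⟩ := LinearMap.surjective h z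
    refine AddChar.sum_eq_zero_of_ne_one (ψ := ψ.compAddMonoidHom l.toAddMonoidHom) ?_
    exact AddChar.ne_one_iff.2 ⟨v, by simpa [hv] using hz⟩

theorem AddChar.sum_dotProduct {ι : Type*} [Fintype ι] [DecidableEq ι]
    {ψ : AddChar (ZMod p) ℂ} (hψ : ψ ≠ 1) (w : ι → ZMod p) :
    ∑ b : ι → ZMod p, ψ (b ⬝ᵥ w) = if w = 0 then (p : ℂ) ^ Fintype.card ι else 0 := by
  classical
  have h := AddChar.sum_comp_linearMap hψ (dotProductBilin (ZMod p) (ZMod p) w)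
  have h0 : dotProductBilin (ZMod p) (ZMod p) w = 0 ↔ w = 0 := by
    refine ⟨fun h => ?_, fun h => by simp [h]⟩
    exact dotProduct_eq_zero _ fun v => by simpa using congrArg (fun l => l v) h
  simp only [h0] at h
  simpa [dotProduct_comm, ZMod.card] using h

theorem AddChar.parseval_dotProduct {ι : Type*} [Fintype ι] [DecidableEq ι]
    {ψ : AddChar (ZMod p) ℂ} (hψ : ψ ≠ 1) (g : (ι → ZMod p) → ℝ) :
    ∑ b : ι → ZMod p, ‖∑ v, (g v : ℂ) * ψ (b ⬝ᵥ v)‖ ^ 2 =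
      (p : ℝ) ^ Fintype.card ι * ∑ v, g v ^ 2 := by
  apply Complex.ofReal_injective
  push_cast
  have key : ∀ b : ι → ZMod p, ((‖∑ v, (g v : ℂ) * ψ (b ⬝ᵥ v)‖ : ℂ)) ^ 2 =
      ∑ v, ∑ w, (g v : ℂ) * g w * ψ (b ⬝ᵥ (v - w)) := by
    intro b
    rw [← Complex.mul_conj', map_sum, sum_mul_sum]
    refine sum_congr rfl fun v _ => sum_congr rfl fun w _ => ?_
    rw [map_mul, Complex.conj_ofReal, ← AddChar.map_neg_eq_conj, dotProduct_sub, sub_eq_add_neg,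
      AddChar.map_add_eq_mul]
    ring
  simp only [key]
  rw [sum_comm, mul_sum]
  refine sum_congr rfl fun v _ => ?_
  rw [sum_comm]
  simp only [← mul_sum, AddChar.sum_dotProduct hψ, sub_eq_zero]
  simp
  ring

/-- If every nontrivial character sum over `C` has modulus at most `δ * #C`, then the image of the
uniform distribution on `C` under independent functionals is nearly uniform in `L¹`. -/
theorem sq_sum_abs_sub_le_of_charSum_le {κ ι : Type*} [Fintype κ] [Fintype ι] [DecidableEq ι]
    {ψ : AddChar (ZMod p) ℂ} (hψ : ψ ≠ 1) {C : Finset (κ → ZMod p)} (hC : C.Nonempty) {δ : ℝ}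
    (hδ : ∀ a : κ → ZMod p, a ≠ 0 → ‖∑ c ∈ C, ψ (c ⬝ᵥ a)‖ ≤ δ * #C)
    {x : ι → κ → ZMod p} (hx : LinearIndependent (ZMod p) x) :
    (∑ v : ι → ZMod p, |(#{c ∈ C | (fun i => c ⬝ᵥ x i) = v} : ℝ) / #C
      - ((p : ℝ) ^ Fintype.card ι)⁻¹|) ^ 2 ≤ (p : ℝ) ^ Fintype.card ι * δ ^ 2 := by
  set P : ℝ := (p : ℝ) ^ Fintype.card ι with hP
  have hp : (0 : ℝ) < p := by exact_mod_cast (Fact.out : p.Prime).pos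
  have hP0 : 0 < P := by positivity
  have hN : (0 : ℝ) < #C := by exact_mod_cast hC.card_pos
  set g : (ι → ZMod p) → ℝ := fun v =>
    (#{c ∈ C | (fun i => c ⬝ᵥ x i) = v} : ℝ) / #C - P⁻¹ with hg
  have hcard : (#(univ : Finset (ι → ZMod p)) : ℝ) = P := by
    simp [hP, ZMod.card]
  have hfourier : ∀ b : ι → ZMod p, ∑ v, (g v : ℂ) * ψ (b ⬝ᵥ v) =
      (∑ c ∈ C, ψ (c ⬝ᵥ ∑ i, b i • x i)) / #C - if b = 0 then 1 else 0 := by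
    intro b
    have h1 : ∑ v : ι → ZMod p, (#{c ∈ C | (fun i => c ⬝ᵥ x i) = v} : ℂ) * ψ (b ⬝ᵥ v) =
        ∑ c ∈ C, ψ (c ⬝ᵥ ∑ i, b i • x i) := by
      simp only [card_filter, Nat.cast_sum, sum_mul]
      rw [sum_comm]
      refine sum_congr rfl fun c _ => ?_
      simp only [Nat.cast_ite, Nat.cast_one, Nat.cast_zero, ite_mul, one_mul, zero_mul, sum_ite_eq,
        mem_univ, if_true]
      simp only [dotProduct_sum, dotProduct_smul, smul_eq_mul]
      rfl
    have h2 : ∑ v : ι → ZMod p, ψ (b ⬝ᵥ v) = if b = 0 then (P : ℂ) else 0 := by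
      simpa [dotProduct_comm, hP] using AddChar.sum_dotProduct hψ b
    have h3 : ∀ v : ι → ZMod p, (g v : ℂ) * ψ (b ⬝ᵥ v) =
        (#{c ∈ C | (fun i => c ⬝ᵥ x i) = v} : ℂ) * ψ (b ⬝ᵥ v) * (#C : ℂ)⁻¹
          - (P : ℂ)⁻¹ * ψ (b ⬝ᵥ v) := by
      intro v
      simp only [hg]
      push_cast
      ring
    simp only [h3, sum_sub_distrib, ← mul_sum, ← sum_mul, h1, h2]
    have : (P : ℂ) ≠ 0 := by exact_mod_cast hP0.ne'
    split_ifs <;> simp [this, div_eq_mul_inv]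
  have hbound : ∀ b : ι → ZMod p, ‖∑ v, (g v : ℂ) * ψ (b ⬝ᵥ v)‖ ^ 2 ≤ δ ^ 2 := by
    intro b
    rw [hfourier b]
    by_cases hb : b = 0
    · have : (#C : ℂ) ≠ 0 := by exact_mod_cast hN.ne'
      simp [hb, this, sq_nonneg]
    · have hne : ∑ i, b i • x i ≠ 0 := fun h =>
        hb (funext fun i => Fintype.linearIndependent_iff.1 hx b h i)
      have := hδ _ hne
      rw [if_neg hb, sub_zero, norm_div, Complex.norm_natCast]
      gcongr
      rwa [div_le_iff₀ hN]
  have hpar := AddChar.parseval_dotProduct hψ g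
  calc (∑ v, |g v|) ^ 2 ≤ #(univ : Finset (ι → ZMod p)) * ∑ v, |g v| ^ 2 :=
        sq_sum_le_card_mul_sum_sq
    _ = ∑ b : ι → ZMod p, ‖∑ v, (g v : ℂ) * ψ (b ⬝ᵥ v)‖ ^ 2 := by
        rw [hpar, hcard]
        simp only [sq_abs]
        rfl
    _ ≤ ∑ _b : ι → ZMod p, δ ^ 2 := sum_le_sum fun b _ => hbound b
    _ = P * δ ^ 2 := by rw [sum_const, nsmul_eq_mul, hcard]

theorem le_card_filter_dotProduct_eq_zero {κ ι : Type*} [Fintype κ] [Fintype ι] [DecidableEq ι]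
    {ψ : AddChar (ZMod p) ℂ} (hψ : ψ ≠ 1) {C : Finset (κ → ZMod p)} {δ : ℝ} (hδ0 : 0 ≤ δ)
    (hδ : ∀ a : κ → ZMod p, a ≠ 0 → ‖∑ c ∈ C, ψ (c ⬝ᵥ a)‖ ≤ δ * #C)
    (x : ι → κ → ZMod p) :
    (1 - (p : ℝ) ^ Fintype.card ι * δ) * #C ≤
      (p : ℝ) ^ Fintype.card ι * #{c ∈ C | ∀ i, c ⬝ᵥ x i = 0} := by
  have hcount : (p : ℂ) ^ Fintype.card ι * #{c ∈ C | ∀ i, c ⬝ᵥ x i = 0} =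
      ∑ b : ι → ZMod p, ∑ c ∈ C, ψ (c ⬝ᵥ ∑ i, b i • x i) := by
    rw [sum_comm, card_filter, Nat.cast_sum, mul_sum]
    refine sum_congr rfl fun c _ => ?_
    have h := AddChar.sum_dotProduct hψ fun i => c ⬝ᵥ x i
    simp only [funext_iff, Pi.zero_apply] at h
    have h' : ∀ b : ι → ZMod p, c ⬝ᵥ ∑ i, b i • x i = b ⬝ᵥ fun i => c ⬝ᵥ x i := by
      intro b
      simp only [dotProduct_sum, dotProduct_smul, smul_eq_mul]
      rfl
    simp only [h', h]
    simp
  have hre := congrArg Complex.re hcount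
  rw [Complex.re_sum] at hre
  have hlow : ∀ b : ι → ZMod p, (if b = 0 then (#C : ℝ) else 0) - δ * #C ≤
      (∑ c ∈ C, ψ (c ⬝ᵥ ∑ i, b i • x i)).re := by
    intro b
    have hnn : 0 ≤ δ * #C := by positivity
    by_cases h : ∑ i, b i • x i = 0
    · have : (if b = 0 then (#C : ℝ) else 0) ≤ #C := by split_ifs <;> simp
      simp only [h, dotProduct_zero, AddChar.map_zero_eq_one, sum_const, nsmul_eq_mul, mul_one,
        Complex.natCast_re]
      linarith
    · have hb : b ≠ 0 := by
        rintro rfl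
        simp at h
      have h1 := hδ _ h
      have h2 := (abs_le.1 (Complex.abs_re_le_norm (∑ c ∈ C, ψ (c ⬝ᵥ ∑ i, b i • x i)))).1
      rw [if_neg hb]
      linarith
  have hsum := sum_le_sum fun b (_ : b ∈ (univ : Finset (ι → ZMod p))) => hlow b
  rw [← hre, sum_sub_distrib] at hsum
  have hcast : ((p : ℂ) ^ Fintype.card ι * #{c ∈ C | ∀ i, c ⬝ᵥ x i = 0}).re =
      (p : ℝ) ^ Fintype.card ι * #{c ∈ C | ∀ i, c ⬝ᵥ x i = 0} := by
    rw [← Complex.ofReal_re ((p : ℝ) ^ Fintype.card ι * _)]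
    push_cast
    rfl
  rw [hcast] at hsum
  simp only [sum_ite_eq', mem_univ, if_true, sum_const, nsmul_eq_mul, card_univ, Fintype.card_fun,
    ZMod.card, Nat.cast_pow] at hsum
  linarith

/-- The powering construction: the graph of `(x, y) ↦ (φ (x y), φ (x² y), …, φ (xⁿ y))` over a field
with `p ^ t` elements has character sums at most `n * p ^ t`. -/
theorem exists_card_eq_charSum_le {κ : Type*} [Fintype κ] {t n : ℕ} (ht : t ≠ 0)
    (hκ : Fintype.card κ = t + t + n) {ψ : AddChar (ZMod p) ℂ} (hψ : ψ ≠ 1) :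
    ∃ C : Finset (κ → ZMod p), #C = p ^ t * p ^ t ∧
      ∀ a : κ → ZMod p, a ≠ 0 → ‖∑ c ∈ C, ψ (c ⬝ᵥ a)‖ ≤ n * p ^ t := by
  classical
  obtain ⟨F, _, _, _, hF, ⟨β⟩⟩ : ∃ (F : Type) (_ : Field F) (_ : Fintype F)
      (_ : Algebra (ZMod p) F), Fintype.card F = p ^ t ∧
        Nonempty (Module.Basis (Fin t) (ZMod p) F) :=
    ⟨GaloisField p t, inferInstance, Fintype.ofFinite _, inferInstance,
      Fintype.card_eq_nat_card.trans (GaloisField.card p t ht),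
      ⟨Module.finBasisOfFinrankEq (ZMod p) _ (GaloisField.finrank p ht)⟩⟩
  let e : κ ≃ (Fin t ⊕ Fin t) ⊕ Fin n := Fintype.equivOfCardEq (by simp [hκ])
  obtain ⟨φ, hφ⟩ : ∃ φ : F →ₗ[ZMod p] ZMod p, φ ≠ 0 :=
    ⟨β.coord ⟨0, Nat.pos_of_ne_zero ht⟩, fun h => by
      simpa using LinearMap.congr_fun h (β ⟨0, Nat.pos_of_ne_zero ht⟩)⟩
  let f : F × F → κ → ZMod p := fun z j =>
    Sum.elim (Sum.elim (β.repr z.1) (β.repr z.2)) (fun i : Fin n => φ (z.2 * z.1 ^ (i.1 + 1))) (e j)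
  have hf : Function.Injective f := by
    rintro ⟨x, y⟩ ⟨x', y'⟩ h
    refine Prod.ext ?_ ?_
    · refine β.repr.injective (Finsupp.ext fun i => ?_)
      simpa [f] using congrFun h (e.symm (.inl (.inl i)))
    · refine β.repr.injective (Finsupp.ext fun i => ?_)
      simpa [f] using congrFun h (e.symm (.inl (.inr i)))
  refine ⟨univ.map ⟨f, hf⟩, by simp [hF], fun a ha => ?_⟩
  let l (b : Fin t → ZMod p) : F →ₗ[ZMod p] ZMod p := ∑ i, b i • β.coord i
  have hl : ∀ b, l b = 0 → b = 0 := fun b hb => funext fun i => by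
    simpa [l, Finsupp.single_apply] using LinearMap.congr_fun hb (β i)
  let a₁ : Fin t → ZMod p := fun i => a (e.symm (.inl (.inl i)))
  let a₂ : Fin t → ZMod p := fun i => a (e.symm (.inl (.inr i)))
  let a₃ : Fin n → ZMod p := fun i => a (e.symm (.inr i))
  let Q : Polynomial F := ∑ i : Fin n, Polynomial.monomial (i.1 + 1) (algebraMap (ZMod p) F (a₃ i))
  let L (x : F) : F →ₗ[ZMod p] ZMod p := l a₂ + φ ∘ₗ LinearMap.mulRight (ZMod p) (Q.eval x)
  have hdot : ∀ x y : F, f (x, y) ⬝ᵥ a = l a₁ x + L x y := by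
    intro x y
    have h1 : f (x, y) ⬝ᵥ a = ∑ s, Sum.elim (Sum.elim (β.repr x) (β.repr y))
        (fun i : Fin n => φ (y * x ^ (i.1 + 1))) s * a (e.symm s) := by
      rw [dotProduct, ← e.symm.sum_comp]
      simp [f]
    have h2 : φ (y * Q.eval x) = ∑ i, φ (y * x ^ (i.1 + 1)) * a₃ i := by
      simp only [Q, Polynomial.eval_finsetSum, Polynomial.eval_monomial, mul_sum, map_sum]
      refine sum_congr rfl fun i _ => ?_
      rw [← Algebra.smul_def, mul_smul_comm, map_smul, smul_eq_mul, mul_comm]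
    rw [h1]
    simp only [Fintype.sum_sum_type, Sum.elim_inl, Sum.elim_inr]
    simp [L, l, h2, a₁, a₂, a₃, mul_comm, add_assoc]
  have hsum : ∑ c ∈ univ.map ⟨f, hf⟩, ψ (c ⬝ᵥ a) =
      ∑ x, if L x = 0 then ψ (l a₁ x) * (p : ℂ) ^ t else 0 := by
    rw [sum_map, Fintype.sum_prod_type]
    refine sum_congr rfl fun x _ => ?_
    simp only [Function.Embedding.coeFn_mk, hdot, AddChar.map_add_eq_mul, ← mul_sum]
    rw [AddChar.sum_comp_linearMap hψ]
    simp [hF]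
  rw [hsum]
  by_cases h3 : a₃ = 0
  · have hQ : Q = 0 := by simp [Q, h3]
    have hL : ∀ x, L x = l a₂ := fun x => by ext y; simp [L, hQ]
    simp only [hL]
    by_cases h2 : l a₂ = 0
    · have h1 : l a₁ ≠ 0 := fun h1 => ha <| funext fun j => by
        obtain ⟨s, rfl⟩ := e.symm.surjective j
        rcases s with (i | i) | i
        · exact congrFun (hl _ h1) i
        · exact congrFun (hl _ h2) i
        · exact congrFun h3 i
      simp only [h2, if_true, ← sum_mul]
      rw [AddChar.sum_comp_linearMap hψ, if_neg h1]
      simp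
      positivity
    · simp [h2]
      positivity
  · have hcard : #{x | L x = 0} ≤ n := by
      rcases (filter (fun x => L x = 0) univ).eq_empty_or_nonempty with h | ⟨x₀, hx₀⟩
      · simp [h]
      have hdeg : Q.natDegree ≤ n :=
        Polynomial.natDegree_sum_le_of_forall_le _ _ fun i _ =>
          (Polynomial.natDegree_monomial_le _).trans i.2
      obtain ⟨i, hi⟩ := Function.ne_iff.1 h3
      have hcoeff : (Q - Polynomial.C (Q.eval x₀)).coeff (i.1 + 1) =
          algebraMap (ZMod p) F (a₃ i) := by
        simp [Q, Polynomial.finsetSum_coeff, Polynomial.coeff_monomial, Fin.val_inj]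
      have hne : Q - Polynomial.C (Q.eval x₀) ≠ 0 := fun h => hi <| by
        rw [h] at hcoeff
        simpa using hcoeff.symm
      refine (card_le_card (t := (Q - Polynomial.C (Q.eval x₀)).roots.toFinset)
        fun x hx => ?_).trans ((Multiset.toFinset_card_le _).trans ((Polynomial.card_roots' _).trans
          (by rwa [Polynomial.natDegree_sub_C])))
      simp only [mem_filter, mem_univ, true_and] at hx hx₀
      rw [Multiset.mem_toFinset, Polynomial.mem_roots hne]
      simp only [Polynomial.IsRoot, Polynomial.eval_sub, Polynomial.eval_C]
      by_contra hd
      refine hφ (LinearMap.ext fun y => ?_)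
      have h1 := LinearMap.congr_fun (hx.trans hx₀.symm) (y / (Q.eval x - Q.eval x₀))
      simp only [L, LinearMap.add_apply, add_right_inj, LinearMap.comp_apply,
        LinearMap.mulRight_apply] at h1
      rw [← sub_eq_zero, ← map_sub, ← mul_sub, div_mul_cancel₀ _ hd] at h1
      simpa using h1
    rw [← sum_filter]
    refine (norm_sum_le _ _).trans ?_
    simp only [norm_mul, AddChar.norm_apply, one_mul, norm_pow, Complex.norm_natCast, sum_const,
      nsmul_eq_mul]
    gcongr

theorem exists_card_le_charSum_sq_le {m k : ℕ} (hm : 1 ≤ m) (hk : 1 ≤ k)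
    {ψ : AddChar (ZMod p) ℂ} (hψ : ψ ≠ 1) :
    ∃ C : Finset (Fin m → ZMod p), C.Nonempty ∧ #C ≤ 4 * m ^ 2 * p ^ (3 * k) ∧
      ∃ δ : ℝ, 0 ≤ δ ∧ 4 * (p : ℝ) ^ (3 * k - 2) * δ ^ 2 ≤ 1 ∧
        ∀ a : Fin m → ZMod p, a ≠ 0 → ‖∑ c ∈ C, ψ (c ⬝ᵥ a)‖ ≤ δ * #C := by
  have hp : p.Prime := Fact.out
  have hex : ∃ t : ℕ, 4 * m ^ 2 * p ^ (3 * k - 2) ≤ p ^ (2 * t) := by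
    refine ⟨4 * m ^ 2 * p ^ (3 * k - 2), (Nat.lt_pow_self hp.one_lt).le.trans ?_⟩
    exact Nat.pow_le_pow_right hp.pos (by omega)
  obtain ⟨t, ht, hmin⟩ : ∃ t : ℕ, 4 * m ^ 2 * p ^ (3 * k - 2) ≤ p ^ (2 * t) ∧
      ∀ s < t, p ^ (2 * s) < 4 * m ^ 2 * p ^ (3 * k - 2) := by
    classical
    exact ⟨Nat.find hex, Nat.find_spec hex, fun s hs => not_le.1 (Nat.find_min hex hs)⟩
  have ht0 : t ≠ 0 := by
    rintro rfl
    have h1 : 1 ≤ m ^ 2 * p ^ (3 * k - 2) := Nat.mul_pos (by positivity) (pow_pos hp.pos _)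
    simp only [mul_zero, pow_zero] at ht
    nlinarith
  have hupper : p ^ (2 * t) ≤ 4 * m ^ 2 * p ^ (3 * k) := by
    have h1 := hmin (t - 1) (by omega)
    have e1 : p ^ (2 * t) = p ^ (2 * (t - 1)) * p ^ 2 := by
      rw [← pow_add]; congr 1; omega
    have e2 : p ^ (3 * k) = p ^ (3 * k - 2) * p ^ 2 := by
      rw [← pow_add]; congr 1; omega
    rw [e1, e2, ← mul_assoc]
    gcongr
  by_cases hmt : 2 * t ≤ m
  · obtain ⟨C, hC, hbias⟩ := exists_card_eq_charSum_le (κ := Fin m) (n := m - 2 * t) ht0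
      (by rw [Fintype.card_fin]; omega) hψ
    have hq : (0 : ℝ) < p ^ t := by exact_mod_cast pow_pos hp.pos t
    refine ⟨C, ?_, ?_, m / p ^ t, by positivity, ?_, fun a ha => (hbias a ha).trans ?_⟩
    · rw [← card_pos, hC]
      exact Nat.mul_pos (pow_pos hp.pos _) (pow_pos hp.pos _)
    · rwa [hC, ← pow_add, ← two_mul]
    · have h1 : (4 * m ^ 2 * p ^ (3 * k - 2) : ℝ) ≤ p ^ (2 * t) := by exact_mod_cast ht
      rw [div_pow, mul_div_assoc', div_le_one (by positivity), ← pow_mul, mul_comm t 2]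
      linarith
    · rw [hC]
      push_cast
      rw [← mul_assoc, div_mul_cancel₀ _ hq.ne']
      gcongr
      omega
  · refine ⟨univ, univ_nonempty, ?_, 0, le_rfl, by simp, fun a ha => ?_⟩
    · rw [card_univ, Fintype.card_fun, ZMod.card, Fintype.card_fin]
      exact (Nat.pow_le_pow_right hp.pos (by omega)).trans hupper
    · rw [AddChar.sum_dotProduct hψ, if_neg ha]
      simp

end SmallBias

theorem stmt_18 (p m k : ℕ) [Fact p.Prime] (hm : 1 ≤ m) (hk : 1 ≤ k) :
    ∃ C : Finset (Fin m → ZMod p), C.Nonempty ∧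
      (C.card : ℝ) ≤ 4 * (m : ℝ) ^ 2 * (p : ℝ) ^ (3 * k) ∧
      (∀ k' : ℕ, 1 ≤ k' → k' ≤ k → ∀ x : Fin k' → Fin m → ZMod p,
        LinearIndependent (ZMod p) x →
          ∑ v : Fin k' → ZMod p,
            |((C.filter fun c => (fun i => ∑ j, c j * x i j) = v).card : ℝ) / (C.card : ℝ)
              - (p : ℝ) ^ (-(k' : ℤ))|
            ≤ 1 / (2 * (p : ℝ) ^ (k - 1))) ∧
      (∀ k' : ℕ, 1 ≤ k' → k' ≤ k - 1 → ∀ x : Fin k' → Fin m → ZMod p,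
        1 / (2 * (p : ℝ) ^ k') ≤
          ((C.filter fun c => ∀ i, ∑ j, c j * x i j = 0).card : ℝ) / (C.card : ℝ)) := by
  have hp : (1 : ℝ) ≤ p := by exact_mod_cast (Fact.out : p.Prime).one_le
  have hψ : ZMod.stdAddChar (N := p) ≠ 1 := by
    intro h
    have := ZMod.injective_stdAddChar (N := p) (a₁ := 1) (a₂ := 0) (by simp [h])
    exact one_ne_zero this
  obtain ⟨C, hC, hcard, δ, hδ0, hδ, hbias⟩ := exists_card_le_charSum_sq_le hm hk hψ
  have hN : (0 : ℝ) < C.card := by exact_mod_cast hC.card_pos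
  refine ⟨C, hC, by exact_mod_cast hcard, fun k' _ hk'k x hx => ?_, fun k' hk'1 hk'k x => ?_⟩
  · have h := sq_sum_abs_sub_le_of_charSum_le hψ hC hbias hx
    rw [Fintype.card_fin] at h
    simp only [zpow_neg, zpow_natCast]
    refine abs_le_of_sq_le_sq' (h.trans ?_) (by positivity) |>.2
    rw [div_pow, one_pow, le_div_iff₀ (by positivity)]
    calc (p : ℝ) ^ k' * δ ^ 2 * (2 * p ^ (k - 1)) ^ 2
        ≤ p ^ k * δ ^ 2 * (2 * p ^ (k - 1)) ^ 2 := by gcongr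
      _ = 4 * (p ^ k * (p ^ (k - 1)) ^ 2) * δ ^ 2 := by ring
      _ = 4 * p ^ (3 * k - 2) * δ ^ 2 := by
          rw [← pow_mul, ← pow_add]
          congr 3
          omega
      _ ≤ 1 := hδ
  · have h := le_card_filter_dotProduct_eq_zero hψ hδ0 hbias x
    rw [Fintype.card_fin] at h
    have hhalf : (p : ℝ) ^ k' * δ ≤ 1 / 2 := by
      refine abs_le_of_sq_le_sq' ?_ (by norm_num) |>.2
      have : (p : ℝ) ^ (k' * 2) ≤ p ^ (3 * k - 2) := pow_le_pow_right₀ hp (by omega)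
      rw [mul_pow, ← pow_mul]
      nlinarith [sq_nonneg δ]
    rw [le_div_iff₀ hN, one_div, inv_mul_le_iff₀ (by positivity)]
    have h2 : (1 / 2 : ℝ) * C.card ≤ (1 - (p : ℝ) ^ k' * δ) * C.card := by
      gcongr
      linarith
    rw [mul_assoc, ← div_le_iff₀' two_pos]
    refine le_trans (by linarith) (h2.trans (h.trans_eq ?_))
    refine congrArg (fun s : Finset (Fin m → ZMod p) => (p : ℝ) ^ k' * s.card) ?_
    ext c
    simp only [Finset.mem_filter]
    rfl
end

section
/- Let A be a finite set of integers and let k ≥ 2 and ℓ ≥ 1 be integers. Then the number of tuples (x_1, …, x_k) ∈ A^k that admit a k-term ℓ-relation is at most ((2ℓ+1)^{k−1} − 1) · |A|^{k−1}. -/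
/-- A nontrivial linear equation in `n + 1` variables has at most `|A| ^ n` solutions in `A`. -/
theorem card_filter_sum_mul_eq_zero_le (A : Finset ℤ) {n : ℕ} (β : Fin (n + 1) → ℤ)
    {i : Fin (n + 1)} (hi : β i ≠ 0) :
    ((Fintype.piFinset fun _ : Fin (n + 1) => A).filter fun x => ∑ j, β j * x j = 0).card
      ≤ A.card ^ n := by
  have hcard : (Fintype.piFinset fun _ : Fin n => A).card = A.card ^ n := by
    simp [Fintype.card_piFinset]
  rw [← hcard]
  refine Finset.card_le_card_of_injOn (fun x j => x (i.succAbove j)) ?_ ?_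
  · intro x hx
    simp only [Finset.coe_filter, Set.mem_ofPred_eq, Fintype.mem_piFinset] at hx
    simpa using fun j => hx.1 (i.succAbove j)
  · intro x hx y hy hxy
    simp only [Finset.coe_filter, Set.mem_ofPred_eq] at hx hy
    have hne : ∀ j, x (i.succAbove j) = y (i.succAbove j) := congrFun hxy
    have hx' := hx.2
    have hy' := hy.2
    rw [Fin.sum_univ_succAbove _ i] at hx' hy'
    simp only [hne] at hx'
    have heq : x i = y i := mul_left_cancel₀ hi (by linarith)
    funext j
    rcases Fin.eq_self_or_eq_succAbove i j with rfl | ⟨m, rfl⟩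
    · exact heq
    · exact hne m

/-- The nonzero vectors in `[-ℓ, ℓ] ^ (n + 1)` with zero sum number at most
`(2 * ℓ + 1) ^ n - 1`. -/
theorem card_filter_ne_zero_sum_eq_zero_le (n ℓ : ℕ) :
    ((Fintype.piFinset fun _ : Fin (n + 1) => Finset.Icc (-(ℓ : ℤ)) ℓ).filter fun β =>
      (∃ i, β i ≠ 0) ∧ ∑ i, β i = 0).card ≤ (2 * ℓ + 1) ^ n - 1 := by
  have hcard : ((Fintype.piFinset fun _ : Fin n => Finset.Icc (-(ℓ : ℤ)) ℓ).erase 0).card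
      = (2 * ℓ + 1) ^ n - 1 := by
    rw [Finset.card_erase_of_mem (by simp)]
    have h : ((ℓ : ℤ) + 1 + ℓ).toNat = 2 * ℓ + 1 := by omega
    simp [Fintype.card_piFinset, h]
  rw [← hcard]
  refine Finset.card_le_card_of_injOn (fun β j => β (Fin.succ j)) ?_ ?_
  · intro β hβ
    simp only [Finset.coe_filter, Set.mem_ofPred_eq, Fintype.mem_piFinset] at hβ
    obtain ⟨hmem, ⟨i, hi⟩, hsum⟩ := hβ
    simp only [Finset.coe_erase, Set.mem_sdiff, Finset.mem_coe, Fintype.mem_piFinset,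
      Set.mem_singleton_iff]
    refine ⟨fun j => hmem _, fun h => hi ?_⟩
    have hz : ∀ j : Fin n, β j.succ = 0 := congrFun h
    rw [Fin.sum_univ_succ] at hsum
    simp only [hz, Finset.sum_const_zero, add_zero] at hsum
    exact Fin.cases hsum hz i
  · intro β hβ γ hγ h
    simp only [Finset.coe_filter, Set.mem_ofPred_eq] at hβ hγ
    have hne : ∀ j : Fin n, β j.succ = γ j.succ := congrFun h
    have hβ' := hβ.2.2
    have hγ' := hγ.2.2
    rw [Fin.sum_univ_succ] at hβ' hγ'
    simp only [hne] at hβ'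
    funext i
    exact Fin.cases (by linarith) hne i

open scoped Classical in
theorem stmt_19 (A : Finset ℤ) (k : ℕ) (hk : 2 ≤ k) (ℓ : ℕ) (hℓ : 1 ≤ ℓ) :
    ((Fintype.piFinset fun _ : Fin k => A).filter fun x =>
        ∃ β : Fin k → ℤ, (∀ i, β i ∈ Finset.Icc (-(ℓ : ℤ)) (ℓ : ℤ)) ∧ (∃ i, β i ≠ 0) ∧
          (∑ i, β i = 0) ∧ (∑ i, β i * x i = 0)).card
      ≤ ((2 * ℓ + 1) ^ (k - 1) - 1) * A.card ^ (k - 1) := by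
  obtain ⟨n, rfl⟩ : ∃ n, k = n + 1 := ⟨k - 1, by omega⟩
  rw [Nat.add_sub_cancel]
  set B := (Fintype.piFinset fun _ : Fin (n + 1) => Finset.Icc (-(ℓ : ℤ)) ℓ).filter fun β =>
      (∃ i, β i ≠ 0) ∧ ∑ i, β i = 0
  have hBcard : B.card ≤ (2 * ℓ + 1) ^ n - 1 := by
    convert card_filter_ne_zero_sum_eq_zero_le n ℓ
  calc _ ≤ (B.biUnion fun β => (Fintype.piFinset fun _ : Fin (n + 1) => A).filter
        fun x => ∑ j, β j * x j = 0).card := by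
        refine Finset.card_le_card fun x hx => ?_
        obtain ⟨hxA, β, hmem, hne, hsum, hrel⟩ := Finset.mem_filter.1 hx
        exact Finset.mem_biUnion.2 ⟨β, Finset.mem_filter.2
          ⟨Fintype.mem_piFinset.2 hmem, hne, hsum⟩, Finset.mem_filter.2 ⟨hxA, hrel⟩⟩
    _ ≤ B.card * A.card ^ n := by
        refine Finset.card_biUnion_le_card_mul _ _ _ fun β hβ => ?_
        obtain ⟨-, ⟨i, hi⟩, -⟩ := Finset.mem_filter.1 hβ
        convert card_filter_sum_mul_eq_zero_le A β hi
    _ ≤ _ := Nat.mul_le_mul_right _ hBcard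
end
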